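/- arXiv:quant-ph/0208020 — 3 statements merged into one kernel-verified Lean document; each statement's English description precedes it below -/
import Mathlib

section
/- Quantum Stein's lemma: Let ρ and σ be density matrices on ℂ^k with σ positive definite. For every ε with 0 < ε < 1, define β*_n(ε) = inf{ Tr(σ^{⊗n} A) : A an operator on (ℂ^k)^{⊗n} with 0 ≤ A ≤ I and Tr(ρ^{⊗n}(I − A)) ≤ ε }. Then lim_{n→∞} −(1/n) log β*_n(ε) exists and equals D(ρ‖σ). -/
open scoped BigOperators Classical ComplexOrder
open Matrix Filter

noncomputable def matFun {d : Type*} [Fintype d] [DecidableEq d] (f : ℝ → ℝ)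
    (A : Matrix d d ℂ) : Matrix d d ℂ :=
  if hA : A.IsHermitian then hA.cfc f else 0

noncomputable def matLog {d : Type*} [Fintype d] [DecidableEq d]
    (A : Matrix d d ℂ) : Matrix d d ℂ :=
  matFun Real.log A

noncomputable def tensPow {k : ℕ} (ρ : Matrix (Fin k) (Fin k) ℂ) (n : ℕ) :
    Matrix (Fin n → Fin k) (Fin n → Fin k) ℂ :=
  fun x y => ∏ i, ρ (x i) (y i)

structure IsPVM {d ι : Type*} [Fintype d] [DecidableEq d] [Fintype ι]
    (E : ι → Matrix d d ℂ) : Prop where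
  herm : ∀ i, (E i).IsHermitian
  idem : ∀ i, E i * E i = E i
  ne_zero : ∀ i, E i ≠ 0
  orth : ∀ i j, i ≠ j → E i * E j = 0
  sum_one : ∑ i, E i = 1

noncomputable def pvmWidth {d ι : Type*} [Fintype d] [DecidableEq d] [Fintype ι]
    (E : ι → Matrix d d ℂ) : ℕ :=
  Finset.univ.sup fun i => (E i).rank

def Refines {d ι κ : Type*} [Fintype d] [DecidableEq d] [Fintype ι] [Fintype κ]
    (M : κ → Matrix d d ℂ) (E : ι → Matrix d d ℂ) : Prop :=
  ∃ f : κ → ι, ∀ i, E i = ∑ j ∈ Finset.univ.filter (fun j => f j = i), M j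

def IsTest {d : Type*} [Fintype d] [DecidableEq d] (A : Matrix d d ℂ) : Prop :=
  A.PosSemidef ∧ (1 - A).PosSemidef

noncomputable def pinch {d ι : Type*} [Fintype d] [DecidableEq d] [Fintype ι]
    (E : ι → Matrix d d ℂ) (A : Matrix d d ℂ) : Matrix d d ℂ :=
  ∑ i, E i * A * E i

/-- Quantum relative entropy `D(ρ‖σ) = Tr ρ (log ρ - log σ)`. -/
noncomputable def qRelEnt {d : Type*} [Fintype d] [DecidableEq d]
    (ρ σ : Matrix d d ℂ) : ℝ :=
  (Matrix.trace (ρ * (matLog ρ - matLog σ))).re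

/-- Exponential Markov bound: under an i.i.d. law with negative drift, the empirical sum is
nonnegative with vanishing probability. -/
theorem tendsto_sum_prod_of_neg_mean {ι : Type*} [Fintype ι] (p f : ι → ℝ)
    (hp : ∀ i, 0 ≤ p i) (hp1 : ∑ i, p i = 1) (hf : ∑ i, p i * f i < 0) :
    Tendsto (fun n : ℕ => ∑ z : Fin n → ι with 0 ≤ ∑ t, f (z t), ∏ t, p (z t))
      atTop (nhds 0) := by
  obtain ⟨s, hs0, hs1⟩ : ∃ s : ℝ, 0 < s ∧ ∑ i, p i * Real.exp (s * f i) < 1 := by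
    have hd : HasDerivAt (fun s : ℝ => ∑ i, p i * Real.exp (s * f i)) (∑ i, p i * f i) 0 := by
      apply HasDerivAt.fun_sum
      intro i _
      have h := (((hasDerivAt_id (0 : ℝ)).mul_const (f i)).exp).const_mul (p i)
      simpa using h
    have hslope := (hasDerivAt_iff_tendsto_slope.mp hd).eventually (gt_mem_nhds hf)
    have hright := hslope.filter_mono
      (nhdsWithin_mono (0 : ℝ) fun x (hx : x ∈ Set.Ioi (0 : ℝ)) => ne_of_gt hx)
    obtain ⟨s, hs, hs0⟩ := (hright.and self_mem_nhdsWithin).exists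
    refine ⟨s, hs0, ?_⟩
    have hs0' : (0 : ℝ) < s := hs0
    rw [slope_def_field, sub_zero, div_lt_iff₀ hs0'] at hs
    simp only [zero_mul, Real.exp_zero, mul_one, hp1] at hs
    linarith
  set q := ∑ i, p i * Real.exp (s * f i) with hq
  have hq0 : 0 ≤ q := Finset.sum_nonneg fun i _ => mul_nonneg (hp i) (Real.exp_pos _).le
  refine squeeze_zero (fun n => Finset.sum_nonneg fun z _ => Finset.prod_nonneg fun t _ => hp _)
    (fun n => ?_) (tendsto_pow_atTop_nhds_zero_of_lt_one hq0 hs1)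
  calc ∑ z : Fin n → ι with 0 ≤ ∑ t, f (z t), ∏ t, p (z t)
      ≤ ∑ z : Fin n → ι with 0 ≤ ∑ t, f (z t), ∏ t, (p (z t) * Real.exp (s * f (z t))) := by
        refine Finset.sum_le_sum fun z hz => ?_
        rw [Finset.prod_mul_distrib, ← Real.exp_sum, ← Finset.mul_sum]
        refine le_mul_of_one_le_right (Finset.prod_nonneg fun t _ => hp _) ?_
        exact Real.one_le_exp (mul_nonneg hs0.le (Finset.mem_filter.mp hz).2)
    _ ≤ ∑ z : Fin n → ι, ∏ t, (p (z t) * Real.exp (s * f (z t))) :=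
        Finset.sum_le_sum_of_subset_of_nonneg (Finset.filter_subset _ _)
          fun z _ _ => Finset.prod_nonneg fun t _ => mul_nonneg (hp _) (Real.exp_pos _).le
    _ = q ^ n := by
        have h := Finset.prod_univ_sum (fun _ : Fin n => (Finset.univ : Finset ι))
          (fun _ i => p i * Real.exp (s * f i))
        simpa [Fintype.piFinset_univ, hq] using h.symm

section TensorPower

variable {k : ℕ}

theorem tensPow_mul (A B : Matrix (Fin k) (Fin k) ℂ) (n : ℕ) :
    tensPow (A * B) n = tensPow A n * tensPow B n := by
  ext x y
  have h := Finset.prod_univ_sum (fun _ : Fin n => (Finset.univ : Finset (Fin k)))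
    (fun t j => A (x t) j * B j (y t))
  simpa [tensPow, Matrix.mul_apply, Fintype.piFinset_univ, Finset.prod_mul_distrib] using h

theorem tensPow_conjTranspose (A : Matrix (Fin k) (Fin k) ℂ) (n : ℕ) :
    tensPow Aᴴ n = (tensPow A n)ᴴ := by
  ext x y
  simp [tensPow, Matrix.conjTranspose_apply]

theorem tensPow_diagonal (a : Fin k → ℂ) (n : ℕ) :
    tensPow (diagonal a) n = diagonal fun x : Fin n → Fin k => ∏ t, a (x t) := by
  ext x y
  by_cases h : x = y
  · subst h
    simp [tensPow]
  · obtain ⟨t, ht⟩ := Function.ne_iff.mp h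
    rw [diagonal_apply_ne _ h]
    exact Finset.prod_eq_zero (Finset.mem_univ t) (diagonal_apply_ne _ ht)

theorem tensPow_one (n : ℕ) : tensPow (1 : Matrix (Fin k) (Fin k) ℂ) n = 1 := by
  rw [← diagonal_one, tensPow_diagonal]
  simp

end TensorPower

/-- The matrix with eigenvalues `a` and eigenvectors the columns of `U`. -/
noncomputable def spectralMatrix {d : Type*} [Fintype d] [DecidableEq d]
    (U : Matrix d d ℂ) (a : d → ℝ) : Matrix d d ℂ :=
  U * diagonal (fun x => (a x : ℂ)) * Uᴴ

theorem mul_conjTranspose_self_apply_self_re {m e : Type*} [Fintype e] (M : Matrix m e ℂ)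
    (x : m) :
    ((M * Mᴴ) x x).re = ∑ y, ‖M x y‖ ^ 2 := by
  simp [Matrix.mul_apply, Complex.mul_conj, Complex.normSq_eq_norm_sq, Complex.re_sum]
  norm_cast

theorem exists_orthonormal_columns {d : Type*} [Fintype d]
    (s : Finset (EuclideanSpace ℂ d)) :
    ∃ (m : ℕ) (C : Matrix d (Fin m) ℂ), m ≤ s.card ∧ Cᴴ * C = 1 ∧
      (∀ i, WithLp.toLp 2 (Cᵀ i) ∈ Submodule.span ℂ (s : Set (EuclideanSpace ℂ d))) ∧
      ∀ g ∈ s, ∑ i, ‖∑ y, star (g y) * C y i‖ ^ 2 = ∑ y, ‖g y‖ ^ 2 := by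
  set W := Submodule.span ℂ (s : Set (EuclideanSpace ℂ d)) with hW
  set B := stdOrthonormalBasis ℂ W with hB
  refine ⟨_, Matrix.of fun y i => (B i : EuclideanSpace ℂ d) y, finrank_span_finset_le_card s,
    ?_, fun i => (B i).2, fun g hg => ?_⟩
  · ext i j
    have h := orthonormal_iff_ite.mp B.orthonormal i j
    rw [Submodule.coe_inner, PiLp.inner_apply] at h
    simpa [Matrix.mul_apply, Matrix.one_apply, mul_comm] using h
  · have h := B.sum_sq_norm_inner_left ⟨g, Submodule.subset_span hg⟩
    rw [Submodule.coe_norm, EuclideanSpace.norm_sq_eq] at h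
    rw [← h]
    refine Finset.sum_congr rfl fun i _ => ?_
    rw [Submodule.coe_inner, PiLp.inner_apply]
    simp [mul_comm]

section SpectralMatrix

variable {d : Type*} [Fintype d] [DecidableEq d]

theorem trace_spectralMatrix_mul (U M : Matrix d d ℂ) (a : d → ℝ) :
    (spectralMatrix U a * M).trace.re = ∑ x, a x * ((Uᴴ * M * U) x x).re := by
  have h : (spectralMatrix U a * M).trace
      = (diagonal (fun x => (a x : ℂ)) * (Uᴴ * M * U)).trace := by
    rw [spectralMatrix, mul_assoc, mul_assoc, trace_mul_comm]
    simp only [mul_assoc]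
  rw [h, trace, Complex.re_sum]
  simp [diagonal_mul]

theorem trace_spectralMatrix_mul_nonneg {U M : Matrix d d ℂ} {a : d → ℝ} (ha : ∀ x, 0 ≤ a x)
    (hM : M.PosSemidef) : 0 ≤ (spectralMatrix U a * M).trace.re := by
  rw [trace_spectralMatrix_mul]
  refine Finset.sum_nonneg fun x _ => mul_nonneg (ha x) ?_
  exact (Complex.le_def.mp ((hM.conjTranspose_mul_mul_same U).diag_nonneg (i := x))).1

theorem trace_spectralMatrix_mul_mul_conjTranspose {U V : Matrix d d ℂ} (hV : V * Vᴴ = 1)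
    (B : Matrix d d ℂ) (a : d → ℝ) :
    (spectralMatrix U a * (B * Bᴴ)).trace.re = ∑ x, ∑ y, a x * ‖(Uᴴ * B * V) x y‖ ^ 2 := by
  rw [trace_spectralMatrix_mul]
  refine Finset.sum_congr rfl fun x _ => ?_
  have h : Uᴴ * (B * Bᴴ) * U = (Uᴴ * B * V) * (Uᴴ * B * V)ᴴ := by
    simp only [conjTranspose_mul, conjTranspose_conjTranspose]
    calc Uᴴ * (B * Bᴴ) * U = Uᴴ * B * (V * Vᴴ) * (Bᴴ * U) := by
          rw [hV]; simp only [mul_assoc, one_mul]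
      _ = _ := by simp only [mul_assoc]
  rw [h, mul_conjTranspose_self_apply_self_re, Finset.mul_sum]

theorem IsTest.one_sub {A : Matrix d d ℂ} (hA : IsTest A) : IsTest (1 - A) :=
  ⟨hA.2, by simpa using hA.1⟩

theorem IsTest.sub_sq_posSemidef {A : Matrix d d ℂ} (hA : IsTest A) :
    (A - A * Aᴴ).PosSemidef := by
  have h1 := hA.2.conjTranspose_mul_mul_same A
  have h2 := hA.1.conjTranspose_mul_mul_same (1 - A)
  rw [hA.1.1] at h1 ⊢
  rw [hA.2.1] at h2
  convert h1.add h2 using 1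
  noncomm_ring

theorem sum_overlap_le_trace_test {U V A : Matrix d d ℂ} (hV : V * Vᴴ = 1) (hA : IsTest A)
    {a : d → ℝ} (ha : ∀ x, 0 ≤ a x) :
    ∑ x, ∑ y, a x * ‖(Uᴴ * A * V) x y‖ ^ 2 ≤ (spectralMatrix U a * A).trace.re := by
  have h := trace_spectralMatrix_mul_nonneg (U := U) ha hA.sub_sq_posSemidef
  rw [mul_sub, trace_sub, Complex.sub_re,
    trace_spectralMatrix_mul_mul_conjTranspose hV] at h
  linarith

theorem norm_add_sq_le_weighted (z w : ℂ) {t : ℝ} (ht : 0 < t) :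
    ‖z + w‖ ^ 2 ≤ (1 + t) * ‖z‖ ^ 2 + (1 + 1 / t) * ‖w‖ ^ 2 := by
  have h1 : ‖z + w‖ ^ 2 ≤ (‖z‖ + ‖w‖) ^ 2 := by gcongr; exact norm_add_le z w
  have h2 : (1 + t) * ‖z‖ ^ 2 + (1 + 1 / t) * ‖w‖ ^ 2 - (‖z‖ + ‖w‖) ^ 2
      = (t * ‖z‖ - ‖w‖) ^ 2 / t := by
    field_simp
    ring
  have h3 : 0 ≤ (t * ‖z‖ - ‖w‖) ^ 2 / t := by positivity
  linarith

/-- Converse bound: the overlap weight on which the spectrum of one matrix is dominated by `c`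
times that of the other is controlled by the two error probabilities of any test. -/
theorem sum_overlap_le_errors {U V A : Matrix d d ℂ} (hU : U * Uᴴ = 1) (hV : V * Vᴴ = 1)
    {a b : d → ℝ} (ha : ∀ x, 0 ≤ a x) (hb : ∀ y, 0 ≤ b y) (hA : IsTest A)
    {c t : ℝ} (hc : 0 ≤ c) (ht : 0 < t) (S : Finset (d × d))
    (hS : ∀ z ∈ S, a z.1 ≤ c * b z.2) :
    ∑ z ∈ S, a z.1 * ‖(Uᴴ * V) z.1 z.2‖ ^ 2
      ≤ (1 + t) * (spectralMatrix U a * (1 - A)).trace.re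
        + (1 + 1 / t) * (c * (spectralMatrix V b * A).trace.re) := by
  have h1 := sum_overlap_le_trace_test (U := U) hV hA.one_sub ha
  have h2 := sum_overlap_le_trace_test (U := V) hU hA hb
  have h2' : ∑ y, ∑ x, b y * ‖(Vᴴ * A * U) y x‖ ^ 2
      = ∑ z : d × d, b z.2 * ‖(Uᴴ * A * V) z.1 z.2‖ ^ 2 := by
    rw [Fintype.sum_prod_type_right]
    refine Finset.sum_congr rfl fun y _ => Finset.sum_congr rfl fun x _ => ?_
    have : (Vᴴ * A * U) y x = star ((Uᴴ * A * V) x y) := by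
      rw [← conjTranspose_apply, conjTranspose_mul, conjTranspose_mul,
        conjTranspose_conjTranspose, hA.1.1, mul_assoc]
    rw [this, norm_star]
  rw [h2'] at h2
  rw [← Fintype.sum_prod_type'] at h1
  have ht' : 0 < 1 + 1 / t := by positivity
  calc ∑ z ∈ S, a z.1 * ‖(Uᴴ * V) z.1 z.2‖ ^ 2
      ≤ ∑ z ∈ S, ((1 + t) * (a z.1 * ‖(Uᴴ * (1 - A) * V) z.1 z.2‖ ^ 2)
          + (1 + 1 / t) * (c * (b z.2 * ‖(Uᴴ * A * V) z.1 z.2‖ ^ 2))) := by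
        refine Finset.sum_le_sum fun z hz => ?_
        have hsplit : (Uᴴ * V) z.1 z.2
            = (Uᴴ * (1 - A) * V) z.1 z.2 + (Uᴴ * A * V) z.1 z.2 := by
          rw [← Matrix.add_apply, ← add_mul, ← mul_add, sub_add_cancel, mul_one]
        have hn := norm_add_sq_le_weighted ((Uᴴ * (1 - A) * V) z.1 z.2)
          ((Uᴴ * A * V) z.1 z.2) ht
        rw [← hsplit] at hn
        have hs := mul_le_mul_of_nonneg_right (hS z hz)
          (mul_nonneg ht'.le (sq_nonneg ‖(Uᴴ * A * V) z.1 z.2‖))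
        have hm := mul_le_mul_of_nonneg_left hn (ha z.1)
        nlinarith
    _ ≤ ∑ z : d × d, ((1 + t) * (a z.1 * ‖(Uᴴ * (1 - A) * V) z.1 z.2‖ ^ 2)
          + (1 + 1 / t) * (c * (b z.2 * ‖(Uᴴ * A * V) z.1 z.2‖ ^ 2))) := by
        refine Finset.sum_le_sum_of_subset_of_nonneg (Finset.subset_univ _) fun z _ _ => ?_
        have := ha z.1
        have := hb z.2
        positivity
    _ ≤ _ := by
        rw [Finset.sum_add_distrib, ← Finset.mul_sum, ← Finset.mul_sum, ← Finset.mul_sum]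
        gcongr

theorem isTest_self_mul_conjTranspose {e : Type*} [Fintype e] [DecidableEq e]
    {C : Matrix d e ℂ} (hC : Cᴴ * C = 1) : IsTest (C * Cᴴ) := by
  refine ⟨posSemidef_self_mul_conjTranspose C, ?_⟩
  have hidem : C * Cᴴ * (C * Cᴴ) = C * Cᴴ := by
    rw [Matrix.mul_assoc, ← Matrix.mul_assoc Cᴴ, hC, Matrix.one_mul]
  have h : 1 - C * Cᴴ = (1 - C * Cᴴ) * (1 - C * Cᴴ)ᴴ := by
    rw [conjTranspose_sub, conjTranspose_one, conjTranspose_mul, conjTranspose_conjTranspose,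
      sub_mul, mul_sub, mul_sub, hidem]
    simp
  rw [h]
  exact posSemidef_self_mul_conjTranspose _

/-- Achievability bound: projecting onto the span of the eigenvectors `x ∈ X` of the first matrix,
truncated to the eigenvalues of the second matrix that are at most `θ`. -/
theorem exists_test_of_truncation {U V : Matrix d d ℂ} (hV : V * Vᴴ = 1)
    {a b : d → ℝ} (ha : ∀ x, 0 ≤ a x) {θ : ℝ} (hθ : 0 ≤ θ) (X : Finset d) :
    ∃ A : Matrix d d ℂ, IsTest A ∧ (spectralMatrix V b * A).trace.re ≤ θ * X.card ∧
      ∑ x ∈ X, ∑ y with b y ≤ θ, a x * ‖(Uᴴ * V) x y‖ ^ 2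
        ≤ (spectralMatrix U a * A).trace.re := by
  have hV' : Vᴴ * V = 1 := mul_eq_one_comm.mp hV
  set g : d → EuclideanSpace ℂ d := fun x =>
    WithLp.toLp 2 fun y => if b y ≤ θ then star ((Uᴴ * V) x y) else 0 with hg
  obtain ⟨m, C, hm, hC, hspan, hpars⟩ := exists_orthonormal_columns (X.image g)
  have hsupp : ∀ y, ¬ b y ≤ θ → ∀ i, C y i = 0 := by
    intro y hy i
    have hle : Submodule.span ℂ ((X.image g : Finset _) : Set (EuclideanSpace ℂ d))
        ≤ LinearMap.ker (EuclideanSpace.proj y : EuclideanSpace ℂ d →L[ℂ] ℂ).toLinearMap := by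
      rw [Submodule.span_le]
      intro v hv
      obtain ⟨x, -, rfl⟩ := Finset.mem_image.mp (Finset.mem_coe.mp hv)
      simp [hg, hy]
    simpa using hle (hspan i)
  have hmX : (m : ℝ) ≤ X.card := by exact_mod_cast hm.trans Finset.card_image_le
  refine ⟨V * C * (V * C)ᴴ, isTest_self_mul_conjTranspose ?_, ?_, ?_⟩
  · rw [conjTranspose_mul, Matrix.mul_assoc, ← Matrix.mul_assoc Vᴴ, hV', Matrix.one_mul, hC]
  · have hconj : Vᴴ * (V * C * (V * C)ᴴ) * V = C * Cᴴ := by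
      calc Vᴴ * (V * C * (V * C)ᴴ) * V = (Vᴴ * V) * (C * Cᴴ) * (Vᴴ * V) := by
            simp only [conjTranspose_mul, Matrix.mul_assoc]
        _ = C * Cᴴ := by rw [hV', Matrix.one_mul, mul_one]
    have hcol : ∀ i, ∑ y, ‖C y i‖ ^ 2 = 1 := by
      intro i
      have h := mul_conjTranspose_self_apply_self_re Cᴴ i
      rw [conjTranspose_conjTranspose, hC] at h
      simpa using h.symm
    rw [trace_spectralMatrix_mul, hconj]
    calc ∑ y, b y * ((C * Cᴴ) y y).re ≤ ∑ y, θ * ∑ i, ‖C y i‖ ^ 2 := by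
          refine Finset.sum_le_sum fun y _ => ?_
          rw [mul_conjTranspose_self_apply_self_re]
          by_cases hy : b y ≤ θ
          · gcongr
          · simp [hsupp y hy]
      _ = θ * m := by
          rw [← Finset.mul_sum, Finset.sum_comm]
          simp [hcol]
      _ ≤ θ * X.card := by gcongr
  · have hconj : Uᴴ * (V * C * (V * C)ᴴ) * U = (Uᴴ * V * C) * (Uᴴ * V * C)ᴴ := by
      simp only [conjTranspose_mul, conjTranspose_conjTranspose, Matrix.mul_assoc]
    rw [trace_spectralMatrix_mul, hconj]
    calc ∑ x ∈ X, ∑ y with b y ≤ θ, a x * ‖(Uᴴ * V) x y‖ ^ 2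
        ≤ ∑ x ∈ X, a x * ((Uᴴ * V * C * (Uᴴ * V * C)ᴴ) x x).re := by
          refine Finset.sum_le_sum fun x hx => ?_
          have h := hpars (g x) (Finset.mem_image_of_mem g hx)
          have hl : ∀ i, ∑ y, star (g x y) * C y i = (Uᴴ * V * C) x i := by
            intro i
            rw [Matrix.mul_apply]
            refine Finset.sum_congr rfl fun y _ => ?_
            by_cases hy : b y ≤ θ
            · simp [hg, hy]
            · simp [hsupp y hy]
          have hr : ∑ y, ‖g x y‖ ^ 2 = ∑ y with b y ≤ θ, ‖(Uᴴ * V) x y‖ ^ 2 := by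
            rw [Finset.sum_filter]
            refine Finset.sum_congr rfl fun y _ => ?_
            by_cases hy : b y ≤ θ <;> simp [hg, hy]
          simp only [hl, hr] at h
          rw [mul_conjTranspose_self_apply_self_re, h, Finset.mul_sum]
      _ ≤ ∑ x, a x * ((Uᴴ * V * C * (Uᴴ * V * C)ᴴ) x x).re := by
          refine Finset.sum_le_sum_of_subset_of_nonneg (Finset.subset_univ _) fun x _ _ => ?_
          refine mul_nonneg (ha x) ?_
          rw [mul_conjTranspose_self_apply_self_re]
          positivity

theorem trace_spectralMatrix_mul_spectralMatrix (U V : Matrix d d ℂ) (a c : d → ℝ) :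
    (spectralMatrix U a * spectralMatrix V c).trace.re
      = ∑ x, ∑ y, a x * ‖(Uᴴ * V) x y‖ ^ 2 * c y := by
  rw [trace_spectralMatrix_mul]
  refine Finset.sum_congr rfl fun x _ => ?_
  have h : Uᴴ * spectralMatrix V c * U
      = (Uᴴ * V) * diagonal (fun y => (c y : ℂ)) * (Uᴴ * V)ᴴ := by
    simp only [spectralMatrix, conjTranspose_mul, conjTranspose_conjTranspose, mul_assoc]
  have hterm : ∀ y, ((Uᴴ * V * diagonal fun y => (c y : ℂ)) x y * (Uᴴ * V)ᴴ y x).re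
      = ‖(Uᴴ * V) x y‖ ^ 2 * c y := by
    intro y
    rw [mul_diagonal, conjTranspose_apply, mul_right_comm, Complex.star_def, Complex.mul_conj,
      Complex.normSq_eq_norm_sq, ← Complex.ofReal_mul, Complex.ofReal_re]
  rw [h, Matrix.mul_apply, Complex.re_sum, Finset.mul_sum]
  exact Finset.sum_congr rfl fun y _ => by rw [hterm, mul_assoc]

theorem sum_norm_sq_unitary_row {U V : Matrix d d ℂ} (hU : U * Uᴴ = 1) (hV : V * Vᴴ = 1) (x : d) :
    ∑ y, ‖(Uᴴ * V) x y‖ ^ 2 = 1 := by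
  have h : Uᴴ * V * (Uᴴ * V)ᴴ = 1 := by
    rw [conjTranspose_mul, conjTranspose_conjTranspose, mul_assoc, ← mul_assoc V, hV, one_mul,
      mul_eq_one_comm.mp hU]
  rw [← mul_conjTranspose_self_apply_self_re, h]
  simp

theorem eigenvectorUnitary_mul_conjTranspose {A : Matrix d d ℂ} (hA : A.IsHermitian) :
    (hA.eigenvectorUnitary : Matrix d d ℂ) * (hA.eigenvectorUnitary : Matrix d d ℂ)ᴴ = 1 :=
  Unitary.coe_mul_star_self hA.eigenvectorUnitary

theorem eq_spectralMatrix {A : Matrix d d ℂ} (hA : A.IsHermitian) :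
    A = spectralMatrix hA.eigenvectorUnitary hA.eigenvalues := by
  conv_lhs => rw [hA.spectral_theorem, Unitary.conjStarAlgAut_apply]
  rfl

theorem matLog_eq_spectralMatrix {A : Matrix d d ℂ} (hA : A.IsHermitian) :
    matLog A = spectralMatrix hA.eigenvectorUnitary fun x => Real.log (hA.eigenvalues x) := by
  rw [matLog, matFun, dif_pos hA, IsHermitian.cfc, Unitary.conjStarAlgAut_apply]
  rfl

theorem qRelEnt_eq_sum_overlap {ρ σ : Matrix d d ℂ} (hρ : ρ.IsHermitian) (hσ : σ.IsHermitian) :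
    qRelEnt ρ σ = ∑ z : d × d, hρ.eigenvalues z.1
      * ‖((hρ.eigenvectorUnitary : Matrix d d ℂ)ᴴ * hσ.eigenvectorUnitary) z.1 z.2‖ ^ 2
      * (Real.log (hρ.eigenvalues z.1) - Real.log (hσ.eigenvalues z.2)) := by
  have hU := eigenvectorUnitary_mul_conjTranspose hρ
  have hV := eigenvectorUnitary_mul_conjTranspose hσ
  set U : Matrix d d ℂ := hρ.eigenvectorUnitary.val with hUdef
  set V : Matrix d d ℂ := hσ.eigenvectorUnitary.val with hVdef
  have hself : (ρ * matLog ρ).trace.re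
      = ∑ x, ∑ y, hρ.eigenvalues x * ‖(Uᴴ * V) x y‖ ^ 2 * Real.log (hρ.eigenvalues x) := by
    conv_lhs => rw [matLog_eq_spectralMatrix hρ]; arg 1; arg 1; arg 1; rw [eq_spectralMatrix hρ]
    rw [trace_spectralMatrix_mul_spectralMatrix, ← hUdef, mul_eq_one_comm.mp hU]
    refine Finset.sum_congr rfl fun x _ => ?_
    rw [← Finset.sum_mul, ← Finset.mul_sum, sum_norm_sq_unitary_row hU hV,
      Finset.sum_eq_single x]
    · simp
    · intro y _ hy
      simp [Matrix.one_apply_ne hy.symm]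
    · simp
  have hcross : (ρ * matLog σ).trace.re
      = ∑ x, ∑ y, hρ.eigenvalues x * ‖(Uᴴ * V) x y‖ ^ 2 * Real.log (hσ.eigenvalues y) := by
    conv_lhs => rw [matLog_eq_spectralMatrix hσ]; arg 1; arg 1; arg 1; rw [eq_spectralMatrix hρ]
    rw [trace_spectralMatrix_mul_spectralMatrix]
  rw [qRelEnt, mul_sub, trace_sub, Complex.sub_re, hself, hcross, Fintype.sum_prod_type,
    ← Finset.sum_sub_distrib]
  refine Finset.sum_congr rfl fun x _ => ?_
  rw [← Finset.sum_sub_distrib]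
  exact Finset.sum_congr rfl fun y _ => by ring

end SpectralMatrix

/-- The joint law of eigenvalue labels of the matrices with eigenbases `U` and `V`, weighted by the
spectrum `a` of the first one. -/
noncomputable def overlapLaw {d : Type*} [Fintype d] (U V : Matrix d d ℂ) (a : d → ℝ)
    (z : d × d) : ℝ :=
  a z.1 * ‖(Uᴴ * V) z.1 z.2‖ ^ 2

theorem overlapLaw_nonneg {d : Type*} [Fintype d] (U V : Matrix d d ℂ) {a : d → ℝ}
    (ha : ∀ x, 0 ≤ a x) (z : d × d) : 0 ≤ overlapLaw U V a z :=
  mul_nonneg (ha _) (sq_nonneg _)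

theorem sum_overlapLaw {d : Type*} [Fintype d] [DecidableEq d] {U V : Matrix d d ℂ} {a : d → ℝ}
    (hU : U * Uᴴ = 1) (hV : V * Vᴴ = 1) : ∑ z, overlapLaw U V a z = ∑ x, a x := by
  rw [Fintype.sum_prod_type]
  refine Finset.sum_congr rfl fun x _ => ?_
  simp only [overlapLaw]
  rw [← Finset.mul_sum, sum_norm_sq_unitary_row hU hV, mul_one]

section Asymptotics

variable {k : ℕ} {U V : Matrix (Fin k) (Fin k) ℂ} {a b : Fin k → ℝ}

theorem tensPow_spectralMatrix (U : Matrix (Fin k) (Fin k) ℂ) (a : Fin k → ℝ) (n : ℕ) :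
    tensPow (spectralMatrix U a) n
      = spectralMatrix (tensPow U n) fun x : Fin n → Fin k => ∏ t, a (x t) := by
  rw [spectralMatrix, tensPow_mul, tensPow_mul, tensPow_diagonal, tensPow_conjTranspose,
    spectralMatrix]
  simp only [Complex.ofReal_prod]

theorem tensPow_mul_conjTranspose_self (hU : U * Uᴴ = 1) (n : ℕ) :
    tensPow U n * (tensPow U n)ᴴ = 1 := by
  rw [← tensPow_conjTranspose, ← tensPow_mul, hU, tensPow_one]

theorem overlapLaw_tensPow (n : ℕ) (z : (Fin n → Fin k) × (Fin n → Fin k)) :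
    overlapLaw (tensPow U n) (tensPow V n) (fun x => ∏ t, a (x t)) z
      = ∏ t, overlapLaw U V a (z.1 t, z.2 t) := by
  simp only [overlapLaw]
  rw [← tensPow_conjTranspose, ← tensPow_mul, Finset.prod_mul_distrib, Finset.prod_pow, tensPow,
    norm_prod]

theorem tendsto_overlapLaw_tail (hU : U * Uᴴ = 1) (hV : V * Vᴴ = 1) (ha : ∀ x, 0 ≤ a x)
    (ha1 : ∑ x, a x = 1) (f : Fin k × Fin k → ℝ) (hf : ∑ z, overlapLaw U V a z * f z < 0) :
    Tendsto (fun n : ℕ => ∑ z : (Fin n → Fin k) × (Fin n → Fin k)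
        with 0 ≤ ∑ t, f (z.1 t, z.2 t),
        overlapLaw (tensPow U n) (tensPow V n) (fun x => ∏ t, a (x t)) z)
      atTop (nhds 0) := by
  have h := tendsto_sum_prod_of_neg_mean (overlapLaw U V a) f (overlapLaw_nonneg U V ha)
    ((sum_overlapLaw hU hV).trans ha1) hf
  refine h.congr fun n => ?_
  refine Finset.sum_equiv (Equiv.arrowProdEquivProdArrow (Fin n) (fun _ => Fin k) fun _ => Fin k)
    (fun z => ?_) fun z _ => ?_
  · simp [Equiv.arrowProdEquivProdArrow]
  · rw [overlapLaw_tensPow]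
    simp [Equiv.arrowProdEquivProdArrow]

theorem prod_le_exp_sum_log {ι : Type*} (s : Finset ι) {c : ι → ℝ} (hc : ∀ i, 0 ≤ c i) :
    ∏ i ∈ s, c i ≤ Real.exp (∑ i ∈ s, Real.log (c i)) := by
  rw [Real.exp_sum]
  refine Finset.prod_le_prod (fun i _ => hc i) fun i _ => ?_
  exact Real.le_exp_log _

theorem prod_eq_exp_sum_log {ι : Type*} (s : Finset ι) {c : ι → ℝ} (hc : ∀ i ∈ s, 0 < c i) :
    ∏ i ∈ s, c i = Real.exp (∑ i ∈ s, Real.log (c i)) := by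
  rw [Real.exp_sum]
  exact Finset.prod_congr rfl fun i hi => (Real.exp_log (hc i hi)).symm

theorem sum_overlapLaw_mul_sub_const (hU : U * Uᴴ = 1) (hV : V * Vᴴ = 1)
    (ha1 : ∑ x, a x = 1) (f : Fin k × Fin k → ℝ) (c : ℝ) :
    ∑ z, overlapLaw U V a z * (f z - c) = ∑ z, overlapLaw U V a z * f z - c := by
  simp only [mul_sub]
  rw [Finset.sum_sub_distrib, ← Finset.sum_mul, sum_overlapLaw hU hV, ha1, one_mul]

theorem sum_overlapLaw_tensPow (hU : U * Uᴴ = 1) (hV : V * Vᴴ = 1) (ha1 : ∑ x, a x = 1) (n : ℕ) :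
    ∑ z, overlapLaw (tensPow U n) (tensPow V n) (fun x => ∏ t, a (x t)) z = 1 := by
  rw [sum_overlapLaw (tensPow_mul_conjTranspose_self hU n) (tensPow_mul_conjTranspose_self hV n)]
  have h := Finset.prod_univ_sum (fun _ : Fin n => (Finset.univ : Finset (Fin k)))
    (fun _ i => a i)
  simpa [Fintype.piFinset_univ, ha1] using h.symm

/-- Strong converse: every test whose first error is at most `ε < 1` has a second error
at least of order `exp (-n (D + δ))`. -/
theorem eventually_le_trace_of_isTest (hU : U * Uᴴ = 1) (hV : V * Vᴴ = 1) (ha : ∀ x, 0 ≤ a x)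
    (ha1 : ∑ x, a x = 1) (hb : ∀ y, 0 < b y) {D : ℝ}
    (hD : D = ∑ z, overlapLaw U V a z * (Real.log (a z.1) - Real.log (b z.2)))
    {ε δ : ℝ} (hε1 : ε < 1) (hδ : 0 < δ) :
    ∃ κ > 0, ∀ᶠ n : ℕ in atTop, ∀ A : Matrix (Fin n → Fin k) (Fin n → Fin k) ℂ, IsTest A →
      (tensPow (spectralMatrix U a) n * (1 - A)).trace.re ≤ ε →
      κ * Real.exp (-(n * (D + δ))) ≤ (tensPow (spectralMatrix V b) n * A).trace.re := by
  have ht : 0 < 1 - ε := by linarith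
  set η := (1 - ε) ^ 2 / 2 with hη
  have hη0 : 0 < η := by positivity
  set r := 1 + 1 / (1 - ε) with hr
  have hr0 : 0 < r := by positivity
  refine ⟨η / r, by positivity, ?_⟩
  have htail := tendsto_overlapLaw_tail hU hV ha ha1
    (fun z => Real.log (a z.1) - Real.log (b z.2) - (D + δ)) (by
      rw [sum_overlapLaw_mul_sub_const hU hV ha1 fun z => Real.log (a z.1) - Real.log (b z.2),
        ← hD]
      linarith)
  filter_upwards [htail.eventually (gt_mem_nhds hη0)] with n hn A hA hAε
  set c := Real.exp (n * (D + δ)) with hc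
  set an : (Fin n → Fin k) → ℝ := fun x => ∏ t, a (x t) with han
  set bn : (Fin n → Fin k) → ℝ := fun y => ∏ t, b (y t) with hbn
  have hgood : ∀ z ∈ Finset.univ.filter (fun z : (Fin n → Fin k) × (Fin n → Fin k) =>
      ¬ 0 ≤ ∑ t, (Real.log (a (z.1 t)) - Real.log (b (z.2 t)) - (D + δ))),
      an z.1 ≤ c * bn z.2 := by
    intro z hz
    have hz' := (Finset.mem_filter.mp hz).2
    simp only [Finset.sum_sub_distrib, Finset.sum_const, Finset.card_univ, Fintype.card_fin,
      nsmul_eq_mul, not_le] at hz'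
    calc an z.1 ≤ Real.exp (∑ t, Real.log (a (z.1 t))) :=
          prod_le_exp_sum_log _ fun t => ha _
      _ ≤ Real.exp (n * (D + δ) + ∑ t, Real.log (b (z.2 t))) :=
          Real.exp_le_exp.mpr (by linarith)
      _ = c * bn z.2 := by
          rw [Real.exp_add, hbn]
          simp only
          rw [prod_eq_exp_sum_log _ fun t _ => hb (z.2 t)]
  have hmain := sum_overlap_le_errors (tensPow_mul_conjTranspose_self hU n)
    (tensPow_mul_conjTranspose_self hV n) (a := an) (b := bn)
    (fun x => Finset.prod_nonneg fun t _ => ha _)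
    (fun y => Finset.prod_nonneg fun t _ => (hb _).le) hA (Real.exp_pos _).le ht _ hgood
  rw [← tensPow_spectralMatrix, ← tensPow_spectralMatrix] at hmain
  have htot := Finset.sum_filter_add_sum_filter_not Finset.univ
    (fun z : (Fin n → Fin k) × (Fin n → Fin k) =>
      0 ≤ ∑ t, (Real.log (a (z.1 t)) - Real.log (b (z.2 t)) - (D + δ)))
    (overlapLaw (tensPow U n) (tensPow V n) an)
  rw [sum_overlapLaw_tensPow hU hV ha1 n] at htot
  have hle : 1 - η ≤ (1 + (1 - ε)) * (tensPow (spectralMatrix U a) n * (1 - A)).trace.re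
      + r * (c * (tensPow (spectralMatrix V b) n * A).trace.re) := by
    refine le_trans ?_ hmain
    simp only [overlapLaw] at htot hn
    linarith
  have hε' : (1 + (1 - ε)) * (tensPow (spectralMatrix U a) n * (1 - A)).trace.re ≤ 1 - 2 * η := by
    have := mul_le_mul_of_nonneg_left hAε (by linarith : 0 ≤ 1 + (1 - ε))
    rw [hη]
    linarith
  rw [Real.exp_neg, ← hc, ← div_eq_mul_inv, div_div, div_le_iff₀ (by positivity)]
  linarith

/-- Direct part: there are tests with first error at most `ε` whose second error is
at most `exp (-n (D - δ))`. -/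
theorem eventually_exists_isTest (hU : U * Uᴴ = 1) (hV : V * Vᴴ = 1) (ha : ∀ x, 0 ≤ a x)
    (ha1 : ∑ x, a x = 1) (hb : ∀ y, 0 < b y) {D : ℝ}
    (hD : D = ∑ z, overlapLaw U V a z * (Real.log (a z.1) - Real.log (b z.2)))
    {ε δ : ℝ} (hε0 : 0 < ε) (hδ : 0 < δ) :
    ∀ᶠ n : ℕ in atTop, ∃ A : Matrix (Fin n → Fin k) (Fin n → Fin k) ℂ, IsTest A ∧
      (tensPow (spectralMatrix U a) n * (1 - A)).trace.re ≤ ε ∧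
      (tensPow (spectralMatrix V b) n * A).trace.re ≤ Real.exp (-(n * (D - δ))) := by
  set α := ∑ z, overlapLaw U V a z * Real.log (a z.1) with hα
  set β := ∑ z, overlapLaw U V a z * Real.log (b z.2) with hβ
  have hDαβ : D = α - β := by
    rw [hD, hα, hβ, ← Finset.sum_sub_distrib]
    exact Finset.sum_congr rfl fun z _ => by ring
  have htail₁ := tendsto_overlapLaw_tail hU hV ha ha1
    (fun z => -Real.log (a z.1) - (-α + δ / 2)) (by
      rw [sum_overlapLaw_mul_sub_const hU hV ha1 fun z => -Real.log (a z.1)]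
      simp only [mul_neg, Finset.sum_neg_distrib]
      linarith)
  have htail₂ := tendsto_overlapLaw_tail hU hV ha ha1
    (fun z => Real.log (b z.2) - (β + δ / 2)) (by
      rw [sum_overlapLaw_mul_sub_const hU hV ha1 fun z => Real.log (b z.2)]
      linarith)
  filter_upwards [htail₁.eventually (gt_mem_nhds (half_pos hε0)),
    htail₂.eventually (gt_mem_nhds (half_pos hε0))] with n hn₁ hn₂
  set an : (Fin n → Fin k) → ℝ := fun x => ∏ t, a (x t) with han
  set bn : (Fin n → Fin k) → ℝ := fun y => ∏ t, b (y t) with hbn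
  have han0 : ∀ x, 0 ≤ an x := fun x => Finset.prod_nonneg fun t _ => ha _
  set τ := Real.exp (n * (α - δ / 2)) with hτ
  set θ := Real.exp (n * (β + δ / 2)) with hθ
  set P := overlapLaw (tensPow U n) (tensPow V n) an with hP
  have hP0 : ∀ z, 0 ≤ P z := overlapLaw_nonneg _ _ han0
  have hPsum : ∑ z, P z = 1 := sum_overlapLaw_tensPow hU hV ha1 n
  have hansum : ∑ x, an x = 1 := by
    rw [← hPsum, sum_overlapLaw (tensPow_mul_conjTranspose_self hU n)
      (tensPow_mul_conjTranspose_self hV n)]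
  set X := Finset.univ.filter fun x => τ ≤ an x with hX
  obtain ⟨A, hA, hσA, hρA⟩ := exists_test_of_truncation (U := tensPow U n)
    (tensPow_mul_conjTranspose_self hV n) (a := an) (b := bn) han0 (Real.exp_pos _).le X (θ := θ)
  rw [← tensPow_spectralMatrix] at hσA hρA
  refine ⟨A, hA, ?_, hσA.trans ?_⟩
  · have htr : (tensPow (spectralMatrix U a) n).trace.re = 1 := by
      have h := trace_spectralMatrix_mul (tensPow U n) 1 an
      rw [mul_one, mul_one, mul_eq_one_comm.mp (tensPow_mul_conjTranspose_self hU n),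
        ← tensPow_spectralMatrix] at h
      rw [h]
      simpa using hansum
    rw [mul_sub, mul_one, trace_sub, Complex.sub_re, htr]
    have hcover : ∑ z, P z
        ≤ ∑ x ∈ X, ∑ y with bn y ≤ θ, P (x, y)
          + (∑ z with 0 ≤ ∑ t, (-Real.log (a (z.1 t)) - (-α + δ / 2)), P z
            + ∑ z with 0 ≤ ∑ t, (Real.log (b (z.2 t)) - (β + δ / 2)), P z) := by
      rw [← Finset.sum_product', Finset.sum_filter, Finset.sum_filter, ← Finset.sum_add_distrib,
        ← Finset.sum_filter_add_sum_filter_not Finset.univ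
          (fun z => z ∈ X ×ˢ Finset.univ.filter fun y => bn y ≤ θ) P,
        Finset.filter_univ_mem]
      refine add_le_add le_rfl ?_
      refine le_trans (Finset.sum_le_sum fun z hz => ?_)
        (Finset.sum_le_sum_of_subset_of_nonneg (Finset.subset_univ _) fun z _ _ => ?_)
      · have hz' := (Finset.mem_filter.mp hz).2
        have hnn : ∀ q : Prop, ∀ [Decidable q], 0 ≤ if q then P z else 0 := by
          intro q _
          split_ifs
          exacts [hP0 z, le_rfl]
        by_cases hx : τ ≤ an z.1
        · have hy : θ < bn z.2 := by
            by_contra hy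
            exact hz' (by simp [hX, hx, not_lt.mp hy])
          have hlog : 0 ≤ ∑ t, (Real.log (b (z.2 t)) - (β + δ / 2)) := by
            rw [hbn, hθ] at hy
            simp only at hy
            rw [prod_eq_exp_sum_log _ fun t _ => hb (z.2 t), Real.exp_lt_exp] at hy
            simp only [Finset.sum_sub_distrib, Finset.sum_const, Finset.card_univ,
              Fintype.card_fin, nsmul_eq_mul]
            linarith
          rw [if_pos hlog]
          exact le_add_of_nonneg_left (hnn _)
        · rcases (han0 z.1).eq_or_lt with h0 | hpos
          · have : P z = 0 := by rw [hP, overlapLaw, ← h0, zero_mul]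
            rw [this]
            simp
          · have hpos' : ∀ t ∈ Finset.univ, 0 < a (z.1 t) := fun t ht =>
              (ha _).lt_of_ne' (Finset.prod_ne_zero_iff.mp hpos.ne' t ht)
            have hlog : 0 ≤ ∑ t, (-Real.log (a (z.1 t)) - (-α + δ / 2)) := by
              rw [not_le, han, hτ] at hx
              simp only at hx
              rw [prod_eq_exp_sum_log _ hpos', Real.exp_lt_exp] at hx
              simp only [Finset.sum_sub_distrib, Finset.sum_const, Finset.card_univ,
                Fintype.card_fin, nsmul_eq_mul, Finset.sum_neg_distrib]
              linarith
            rw [if_pos hlog]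
            exact le_add_of_nonneg_right (hnn _)
      · refine add_nonneg ?_ ?_ <;> split_ifs <;> first | exact hP0 z | exact le_rfl
    rw [hPsum] at hcover
    simp only [hP, overlapLaw] at hcover hn₁ hn₂
    linarith
  · have hcard : τ * X.card ≤ 1 := by
      calc τ * X.card = ∑ x ∈ X, τ := by rw [Finset.sum_const, nsmul_eq_mul, mul_comm]
        _ ≤ ∑ x ∈ X, an x := Finset.sum_le_sum fun x hx => (Finset.mem_filter.mp hx).2
        _ ≤ ∑ x, an x := Finset.sum_le_sum_of_subset_of_nonneg (Finset.subset_univ _)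
            fun x _ _ => han0 x
        _ = 1 := hansum
    have hexp : θ = Real.exp (-(n * (D - δ))) * τ := by
      rw [hθ, hτ, ← Real.exp_add, hDαβ]
      congr 1
      ring
    rw [hexp, mul_assoc]
    exact mul_le_of_le_one_right (Real.exp_pos _).le hcard

end Asymptotics

theorem tendsto_neg_log_div_of_exp_bounds {u : ℕ → ℝ} {D : ℝ}
    (hlower : ∀ δ > 0, ∃ κ > 0, ∀ᶠ n : ℕ in atTop, κ * Real.exp (-(n * (D + δ))) ≤ u n)
    (hupper : ∀ δ > 0, ∀ᶠ n : ℕ in atTop, u n ≤ Real.exp (-(n * (D - δ)))) :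
    Tendsto (fun n : ℕ => -(1 / (n : ℝ)) * Real.log (u n)) atTop (nhds D) := by
  refine tendsto_order.mpr ⟨fun c hc => ?_, fun c hc => ?_⟩
  · obtain ⟨κ, hκ, hl⟩ := hlower 1 one_pos
    filter_upwards [hl, hupper ((D - c) / 2) (by linarith), eventually_gt_atTop 0]
      with n hln hun hn
    have hn' : (0 : ℝ) < n := by exact_mod_cast hn
    have hu0 : 0 < u n := lt_of_lt_of_le (by positivity) hln
    have hlog := Real.log_le_log hu0 hun
    rw [Real.log_exp] at hlog
    rw [neg_mul, one_div_mul_eq_div, ← neg_div, lt_div_iff₀ hn']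
    nlinarith
  · set δ := (c - D) / 2 with hδ
    have hδ0 : 0 < δ := by linarith
    obtain ⟨κ, hκ, hl⟩ := hlower δ hδ0
    have hlim : Tendsto (fun n : ℕ => (n : ℝ) * δ) atTop atTop :=
      tendsto_natCast_atTop_atTop.atTop_mul_const hδ0
    filter_upwards [hl, hlim.eventually_gt_atTop (-Real.log κ), eventually_gt_atTop 0]
      with n hln hnκ hn
    have hn' : (0 : ℝ) < n := by exact_mod_cast hn
    have hlog := Real.log_le_log (by positivity) hln
    rw [Real.log_mul hκ.ne' (Real.exp_pos _).ne', Real.log_exp] at hlog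
    rw [neg_mul, one_div_mul_eq_div, ← neg_div, div_lt_iff₀ hn']
    have : c = D + 2 * δ := by rw [hδ]; ring
    rw [this]
    linarith

/-- **Quantum Stein's lemma.** For density matrices `ρ, σ` on `ℂ^k` with `σ` positive
definite and any `0 < ε < 1`, the sequence `-(1/n) log β*_n(ε)` converges to `D(ρ‖σ)`,
where `β*_n(ε)` is the minimal second error probability among tests whose first error
probability is at most `ε`. -/
theorem stmt_0 (k : ℕ) (ρ σ : Matrix (Fin k) (Fin k) ℂ)
    (hρ : ρ.PosSemidef) (hρ1 : ρ.trace = 1)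
    (hσ : σ.PosDef) (hσ1 : σ.trace = 1)
    (ε : ℝ) (hε0 : 0 < ε) (hε1 : ε < 1) :
    Filter.Tendsto
      (fun n : ℕ => -(1 / (n : ℝ)) * Real.log
        (sInf {x : ℝ | ∃ A : Matrix (Fin n → Fin k) (Fin n → Fin k) ℂ,
          IsTest A ∧ (Matrix.trace (tensPow ρ n * (1 - A))).re ≤ ε ∧
          x = (Matrix.trace (tensPow σ n * A)).re}))
      Filter.atTop (nhds (qRelEnt ρ σ)) := by
  have hU := eigenvectorUnitary_mul_conjTranspose hρ.1
  have hV := eigenvectorUnitary_mul_conjTranspose hσ.1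
  have ha := hρ.eigenvalues_nonneg
  have hb := hσ.eigenvalues_pos
  have ha1 : ∑ x, hρ.1.eigenvalues x = 1 := by
    have h := hρ.1.trace_eq_sum_eigenvalues
    rw [hρ1] at h
    have h' := congrArg Complex.re h
    simpa using h'.symm
  have hD := qRelEnt_eq_sum_overlap hρ.1 hσ.1
  have hρs := eq_spectralMatrix hρ.1
  have hσs := eq_spectralMatrix hσ.1
  refine tendsto_neg_log_div_of_exp_bounds (fun δ hδ => ?_) fun δ hδ => ?_
  · obtain ⟨κ, hκ, h⟩ := eventually_le_trace_of_isTest hU hV ha ha1 hb hD hε1 hδ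
    refine ⟨κ, hκ, ?_⟩
    rw [← hρs, ← hσs] at h
    filter_upwards [h, eventually_exists_isTest hU hV ha ha1 hb hD hε0 hδ] with n hn hex
    rw [← hρs, ← hσs] at hex
    obtain ⟨A, hA, hAε, -⟩ := hex
    refine le_csInf ⟨_, A, hA, hAε, rfl⟩ ?_
    rintro x ⟨A', hA', hAε', rfl⟩
    exact hn A' hA' hAε'
  · have hnonneg : ∀ n, ∀ A : Matrix (Fin n → Fin k) (Fin n → Fin k) ℂ, IsTest A →
        0 ≤ (tensPow σ n * A).trace.re := by
      intro n A hA
      rw [hσs, tensPow_spectralMatrix]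
      exact trace_spectralMatrix_mul_nonneg
        (fun y => Finset.prod_nonneg fun t _ => (hb _).le) hA.1
    have h := eventually_exists_isTest hU hV ha ha1 hb hD hε0 hδ
    rw [← hρs, ← hσs] at h
    filter_upwards [h] with n hex
    obtain ⟨A, hA, hAε, hAσ⟩ := hex
    refine le_trans (csInf_le ⟨0, ?_⟩ ⟨A, hA, hAε, rfl⟩) hAσ
    rintro x ⟨A', hA', -, rfl⟩
    exact hnonneg n A' hA'
end

section
/- Lemma 5 (pinching log-variance bound): Let E and M be PVMs on ℂ^d such that M refines E, let ρ be a positive definite density matrix on ℂ^d commuting with every element of E, and suppose w(E) ≥ 3. Then Tr( ρ (log ρ − log ℰ_M(ρ))² ) ≤ 4 (log w(E))², where ℰ_M(ρ) = Σ_j M_j ρ M_j. -/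
open scoped BigOperators Classical ComplexOrder
open Matrix Filter

section PinchingBounds

lemma posSemidef_card_smul_sum_sub {n κ : Type*} [Fintype n] (s : Finset κ) {M : κ → Matrix n n ℂ}
    (hM : ∀ j, (M j).IsHermitian) {A : Matrix n n ℂ} (hA : A.PosSemidef) :
    ((s.card : ℂ) • ∑ j ∈ s, M j * A * M j
      - (∑ j ∈ s, M j) * A * ∑ j ∈ s, M j).PosSemidef := by
  have h1 : (∑ j ∈ s, ∑ k ∈ s, (M j - M k) * A * (M j - M k)).PosSemidef := by
    refine posSemidef_sum _ fun j _ => posSemidef_sum _ fun k _ => ?_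
    have := hA.conjTranspose_mul_mul_same (M j - M k)
    rwa [conjTranspose_sub, (hM j).eq, (hM k).eq] at this
  have h2 : ∑ j ∈ s, ∑ k ∈ s, (M j - M k) * A * (M j - M k) =
      (2 : ℂ) • ((s.card : ℂ) • ∑ j ∈ s, M j * A * M j
        - (∑ j ∈ s, M j) * A * ∑ j ∈ s, M j) := by
    simp only [mul_sub, sub_mul, Finset.sum_sub_distrib, Finset.sum_const, Finset.sum_mul,
      Finset.mul_sum, smul_sub, two_smul, Nat.cast_smul_eq_nsmul, ← Finset.smul_sum]
    rw [Finset.sum_comm (f := fun j k => M k * A * M j)]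
    abel
  rw [h2] at h1
  have := h1.smul (show (0 : ℂ) ≤ 1 / 2 by norm_num [Complex.le_def])
  rwa [smul_smul, show (1 / 2 * 2 : ℂ) = 1 by norm_num, one_smul] at this

variable {n : Type*} [Fintype n] [DecidableEq n]

/-- `log² x ≤ (4 / e²) x` for `x ≥ 1`, with `4 / e²` rounded up to `3 / 5`. -/
lemma sq_log_le_of_one_le {x : ℝ} (hx : 1 ≤ x) : Real.log x ^ 2 ≤ 3 / 5 * x := by
  have hx0 : 0 < x := by linarith
  have hs : 0 < √x := Real.sqrt_pos.2 hx0
  have he := Real.exp_pos 1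
  have h1 : Real.log (√x / Real.exp 1) ≤ √x / Real.exp 1 - 1 :=
    Real.log_le_sub_one_of_pos (by positivity)
  rw [Real.log_div hs.ne' he.ne', Real.log_exp, Real.log_sqrt hx0.le] at h1
  have h2 : √x / Real.exp 1 ≤ √x * (10 / 27) := by
    rw [div_le_iff₀ he]
    nlinarith [Real.exp_one_gt_d9]
  have h3 : Real.log x ≤ 20 / 27 * √x := by linarith
  have h4 := pow_le_pow_left₀ (Real.log_nonneg hx) h3 2
  rw [mul_pow, Real.sq_sqrt hx0.le] at h4
  linarith

lemma sq_log_le {w y : ℝ} (hw : 1 ≤ w) (hy : 0 < y) :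
    Real.log y ^ 2 ≤ 2 * Real.log w ^ 2 + 6 / 5 * (y / w) + 3 / 5 * y⁻¹ := by
  have hw0 : 0 < w := by linarith
  have hL := Real.log_nonneg hw
  have hyw : 0 < y / w := by positivity
  have hyi : 0 < y⁻¹ := by positivity
  rcases le_total y 1 with h | h
  · have := sq_log_le_of_one_le ((one_le_inv₀ hy).2 h)
    rw [Real.log_inv, neg_sq] at this
    nlinarith
  rcases le_total y w with h' | h'
  · have := pow_le_pow_left₀ (Real.log_nonneg h) (Real.log_le_log hy h') 2
    nlinarith
  · have := sq_log_le_of_one_le ((one_le_div hw0).2 h')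
    rw [Real.log_div hy.ne' hw0.ne'] at this
    nlinarith [sq_nonneg (Real.log y - 2 * Real.log w)]

lemma one_le_log_of_three_le {w : ℝ} (hw : 3 ≤ w) : 1 ≤ Real.log w := by
  rw [Real.le_log_iff_exp_le (by linarith)]
  linarith [Real.exp_one_lt_d9]

lemma Matrix.IsHermitian.cfc_mul_cfc {A : Matrix n n ℂ} (hA : A.IsHermitian) (f g : ℝ → ℝ) :
    hA.cfc f * hA.cfc g = hA.cfc fun x => f x * g x := by
  simp only [Matrix.IsHermitian.cfc, ← map_mul, diagonal_mul_diagonal]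
  congr 2
  ext i
  simp

lemma Matrix.IsHermitian.cfc_id_eq {A : Matrix n n ℂ} (hA : A.IsHermitian) :
    hA.cfc (fun x => x) = A := hA.spectral_theorem.symm

lemma Matrix.IsHermitian.cfc_one_eq {A : Matrix n n ℂ} (hA : A.IsHermitian) :
    hA.cfc (fun _ => 1) = 1 := by
  rw [← hA.cfc_eq]
  exact cfc_const_one ℝ A hA

lemma Matrix.IsHermitian.cfc_isHermitian {A : Matrix n n ℂ} (hA : A.IsHermitian) (f : ℝ → ℝ) :
    (hA.cfc f).IsHermitian := by
  rw [← hA.cfc_eq]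
  exact cfc_predicate f A

lemma Matrix.PosDef.mul_cfc_inv {A : Matrix n n ℂ} (hA : A.PosDef) :
    A * hA.isHermitian.cfc (fun x => x⁻¹) = 1 := by
  nth_rw 1 [← IsHermitian.cfc_id_eq hA.isHermitian]
  rw [IsHermitian.cfc_mul_cfc, ← IsHermitian.cfc_one_eq hA.isHermitian]
  simp only [Matrix.IsHermitian.cfc]
  congr 2
  ext i
  have hi := (hA.eigenvalues_pos i).ne'
  simp [hi]

/-- Squared moduli of the overlaps between the eigenvectors of two Hermitian matrices. -/
noncomputable def eigenOverlap {A B : Matrix n n ℂ} (hA : A.IsHermitian) (hB : B.IsHermitian)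
    (a b : n) : ℝ :=
  Complex.normSq ((star (hA.eigenvectorUnitary : Matrix n n ℂ) *
    (hB.eigenvectorUnitary : Matrix n n ℂ)) a b)

lemma trace_cfc_mul_cfc {A B : Matrix n n ℂ} (hA : A.IsHermitian) (hB : B.IsHermitian)
    (f g : ℝ → ℝ) :
    trace (hA.cfc f * hB.cfc g) = ((∑ a, ∑ b, f (hA.eigenvalues a) * g (hB.eigenvalues b) *
      eigenOverlap hA hB a b : ℝ) : ℂ) := by
  set U : Matrix n n ℂ := hA.eigenvectorUnitary.1 with hU
  set V : Matrix n n ℂ := hB.eigenvectorUnitary.1 with hV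
  set W := star U * V with hW
  have h1 : trace (hA.cfc f * hB.cfc g) =
      trace (diagonal (fun i => (f (hA.eigenvalues i) : ℂ)) * W *
        diagonal (fun i => (g (hB.eigenvalues i) : ℂ)) * star W) := by
    simp only [Matrix.IsHermitian.cfc, Unitary.conjStarAlgAut_apply, hW, star_mul, star_star]
    rw [← hU, ← hV, Matrix.mul_assoc, Matrix.mul_assoc, trace_mul_comm]
    simp only [Matrix.mul_assoc]
    rfl
  rw [h1, trace]
  push_cast
  refine Finset.sum_congr rfl fun a _ => ?_
  rw [diag_apply, Matrix.mul_apply]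
  refine Finset.sum_congr rfl fun b _ => ?_
  rw [mul_diagonal, diagonal_mul, star_apply, eigenOverlap, ← hU, ← hV, ← hW,
    Complex.normSq_eq_conj_mul_self]
  simp only [RCLike.star_def]
  ring

lemma eigenOverlap_nonneg {A B : Matrix n n ℂ} (hA : A.IsHermitian) (hB : B.IsHermitian)
    (a b : n) : 0 ≤ eigenOverlap hA hB a b := Complex.normSq_nonneg _

lemma trace_mul_cfc_sub_sq {A B : Matrix n n ℂ} (hA : A.IsHermitian) (hB : B.IsHermitian)
    (f g : ℝ → ℝ) :
    trace (A * (hA.cfc f - hB.cfc g) ^ 2) = ((∑ a, ∑ b, hA.eigenvalues a *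
      (f (hA.eigenvalues a) - g (hB.eigenvalues b)) ^ 2 * eigenOverlap hA hB a b : ℝ) : ℂ) := by
  have h0 : trace (A * (hA.cfc f - hB.cfc g) ^ 2) =
      trace (hA.cfc (fun x => x * (f x * f x)) * hB.cfc fun _ => 1)
        - 2 * trace (hA.cfc (fun x => x * f x) * hB.cfc g)
        + trace (hA.cfc (fun x => x) * hB.cfc fun x => g x * g x) := by
    have e1 : trace (A * hB.cfc g * hA.cfc f) = trace (A * hA.cfc f * hB.cfc g) := by
      have : hA.cfc f * A = A * hA.cfc f := by
        nth_rw 2 [← IsHermitian.cfc_id_eq hA]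
        nth_rw 3 [← IsHermitian.cfc_id_eq hA]
        simp only [IsHermitian.cfc_mul_cfc, mul_comm]
      rw [trace_mul_comm, ← Matrix.mul_assoc, this]
    rw [IsHermitian.cfc_one_eq, ← IsHermitian.cfc_mul_cfc, ← IsHermitian.cfc_mul_cfc,
      ← IsHermitian.cfc_mul_cfc, ← IsHermitian.cfc_mul_cfc, IsHermitian.cfc_id_eq, pow_two]
    simp only [mul_sub, sub_mul, trace_sub, ← Matrix.mul_assoc, e1, Matrix.mul_one]
    ring
  rw [h0, trace_cfc_mul_cfc, trace_cfc_mul_cfc, trace_cfc_mul_cfc]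
  norm_cast
  rw [Finset.mul_sum, ← Finset.sum_sub_distrib, ← Finset.sum_add_distrib]
  refine Finset.sum_congr rfl fun a _ => ?_
  rw [Finset.mul_sum, ← Finset.sum_sub_distrib, ← Finset.sum_add_distrib]
  refine Finset.sum_congr rfl fun b _ => ?_
  ring

/-- If `A ≤ w B`, then `Tr A² B⁻¹ ≤ w Tr A`. -/
lemma trace_mul_mul_le {A B C : Matrix n n ℂ} (hA : A.PosSemidef) (hC : C.IsHermitian)
    (hBC : B * C = 1) {w : ℝ} (hw : 0 < w) (h : ((w : ℂ) • B - A).PosSemidef) :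
    (trace (A * A * C)).re ≤ w * (trace A).re := by
  have hCB : C * B = 1 := mul_eq_one_comm.1 hBC
  have h1 := (h.conjTranspose_mul_mul_same (C * A)).trace_nonneg
  have h2 := (hA.conjTranspose_mul_mul_same (C * A - (w : ℂ) • 1)).trace_nonneg
  have e1 : (C * A)ᴴ * ((w : ℂ) • B - A) * (C * A) =
      (w : ℂ) • (A * C * A) - A * C * A * C * A := by
    rw [conjTranspose_mul, hA.isHermitian.eq, hC.eq]
    simp only [mul_sub, sub_mul, Matrix.mul_smul, Matrix.smul_mul, ← Matrix.mul_assoc]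
    rw [Matrix.mul_assoc A C B, hCB, Matrix.mul_one]
  have e2 : (C * A - (w : ℂ) • 1)ᴴ * A * (C * A - (w : ℂ) • 1) =
      A * C * A * C * A - (w : ℂ) • (A * C * A) - (w : ℂ) • (A * C * A)
        + ((w : ℂ) * w) • A := by
    rw [conjTranspose_sub, conjTranspose_mul, hA.isHermitian.eq, hC.eq, conjTranspose_smul]
    simp only [mul_sub, sub_mul, Matrix.mul_smul, Matrix.smul_mul, ← Matrix.mul_assoc,
      conjTranspose_one, Matrix.one_mul, Matrix.mul_one, RCLike.star_def, Complex.conj_ofReal,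
      smul_smul]
    abel
  have e3 : trace (A * C * A) = trace (A * A * C) := by
    rw [trace_mul_comm, Matrix.mul_assoc]
  rw [e1, trace_sub, trace_smul, e3] at h1
  rw [e2, trace_add, trace_sub, trace_sub, trace_smul, trace_smul, e3] at h2
  have h3 := (Complex.le_def.1 (add_nonneg h1 h2)).1
  simp at h3
  nlinarith

lemma natCast_rank_eq_trace {P : Matrix n n ℂ} (hP : P * P = P) : (P.rank : ℂ) = trace P := by
  have hid : IsIdempotentElem (toLin' P) := by
    rw [IsIdempotentElem, Module.End.mul_eq_comp, ← toLin'_mul, hP]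
  have := (LinearMap.IsIdempotentElem.isProj_range _ hid).trace
  rw [trace_toLin'_eq] at this
  rw [this]
  rfl

lemma card_le_rank_sum {κ : Type*} [Fintype κ] {M : κ → Matrix n n ℂ} (hM : IsPVM M)
    (s : Finset κ) : s.card ≤ (∑ j ∈ s, M j).rank := by
  have hid : (∑ j ∈ s, M j) * ∑ j ∈ s, M j = ∑ j ∈ s, M j := by
    rw [Finset.sum_mul_sum]
    refine Finset.sum_congr rfl fun j hj => ?_
    rw [Finset.sum_eq_single_of_mem j hj fun k _ hk => hM.orth j k hk.symm, hM.idem]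
  have h : (∑ j ∈ s, M j).rank = ∑ j ∈ s, (M j).rank := by
    have : ((∑ j ∈ s, M j).rank : ℂ) = ∑ j ∈ s, ((M j).rank : ℂ) := by
      rw [natCast_rank_eq_trace hid, trace_sum]
      exact Finset.sum_congr rfl fun j _ => (natCast_rank_eq_trace (hM.idem j)).symm
    exact_mod_cast this
  rw [h, Finset.card_eq_sum_ones]
  refine Finset.sum_le_sum fun j _ => ?_
  refine Nat.one_le_iff_ne_zero.2 fun h0 => hM.ne_zero j ?_
  rw [Matrix.rank, Submodule.finrank_eq_zero, LinearMap.range_eq_bot] at h0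
  exact (toLin' (R := ℂ)).map_eq_zero_iff.1 h0

/-- The pinching inequality `ρ ≤ w(E) ℰ_M(ρ)`. -/
lemma posSemidef_width_smul_pinch_sub {ι κ : Type*} [Fintype ι] [Fintype κ]
    {E : ι → Matrix n n ℂ} {M : κ → Matrix n n ℂ} (hE : IsPVM E) (hM : IsPVM M)
    (hRef : Refines M E) {ρ : Matrix n n ℂ} (hρ : ρ.PosSemidef)
    (hcomm : ∀ i, ρ * E i = E i * ρ) :
    (((pvmWidth E : ℝ) : ℂ) • pinch M ρ - ρ).PosSemidef := by
  obtain ⟨f, hf⟩ := hRef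
  have hρE : ρ = ∑ i, E i * ρ * E i := by
    simp only [Matrix.mul_assoc, hcomm]
    simp only [← Matrix.mul_assoc, hE.idem, ← Finset.sum_mul, hE.sum_one, Matrix.one_mul]
  have hpinch : pinch M ρ = ∑ i, ∑ j ∈ Finset.univ.filter (fun j => f j = i), M j * ρ * M j :=
    (Finset.sum_fiberwise _ _ _).symm
  nth_rw 2 [hρE]
  rw [hpinch, Finset.smul_sum, ← Finset.sum_sub_distrib]
  refine posSemidef_sum _ fun i _ => ?_
  set s := Finset.univ.filter (fun j => f j = i) with hs
  have hcard : s.card ≤ pvmWidth E := by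
    refine (card_le_rank_sum hM s).trans ?_
    rw [← hf i]
    exact Finset.le_sup (f := fun i => (E i).rank) (Finset.mem_univ i)
  have h1 := posSemidef_card_smul_sum_sub s hM.herm hρ
  rw [← hf i] at h1
  have h2 : (∑ j ∈ s, M j * ρ * M j).PosSemidef := posSemidef_sum _ fun j _ => by
    have := hρ.conjTranspose_mul_mul_same (M j)
    rwa [(hM.herm j).eq] at this
  have h3 : (0 : ℂ) ≤ ((pvmWidth E : ℝ) : ℂ) - s.card := by
    rw [sub_nonneg]; exact_mod_cast hcard
  have h4 := h1.add (h2.smul h3)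
  rw [sub_smul] at h4
  convert h4 using 1
  abel

lemma trace_pinch {κ : Type*} [Fintype κ] {M : κ → Matrix n n ℂ} (hM : IsPVM M)
    (A : Matrix n n ℂ) : trace (pinch M A) = trace A := by
  rw [pinch, trace_sum]
  simp_rw [fun j => trace_mul_comm (M j * A) (M j), ← Matrix.mul_assoc, hM.idem]
  rw [← trace_sum, ← Finset.sum_mul, hM.sum_one, Matrix.one_mul]

/-- Log-variance bound for a pair of states with `A ≤ w B`. -/
lemma trace_mul_log_sub_log_sq_le {A B : Matrix n n ℂ} (hA : A.PosDef) (hB : B.PosDef)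
    (hA1 : trace A = 1) (hB1 : trace B = 1) {w : ℝ} (hw : 3 ≤ w)
    (h : ((w : ℂ) • B - A).PosSemidef) :
    (trace (A * (hA.isHermitian.cfc Real.log - hB.isHermitian.cfc Real.log) ^ 2)).re
      ≤ 4 * Real.log w ^ 2 := by
  have hw0 : 0 < w := by linarith
  set p := hA.isHermitian.eigenvalues with hp
  set q := hB.isHermitian.eigenvalues with hq
  set c := eigenOverlap hA.isHermitian hB.isHermitian with hc
  have hA' : ∑ a, ∑ b, p a * c a b = 1 := by
    have := trace_cfc_mul_cfc hA.isHermitian hB.isHermitian (fun x => x) (fun _ => 1)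
    rw [IsHermitian.cfc_id_eq, IsHermitian.cfc_one_eq, Matrix.mul_one, hA1] at this
    simp only [mul_one] at this
    exact_mod_cast this.symm
  have hB' : ∑ a, ∑ b, q b * c a b = 1 := by
    have := trace_cfc_mul_cfc hA.isHermitian hB.isHermitian (fun _ => 1) (fun x => x)
    rw [IsHermitian.cfc_id_eq, IsHermitian.cfc_one_eq, Matrix.one_mul, hB1] at this
    simp only [one_mul] at this
    exact_mod_cast this.symm
  have hAB : ∑ a, ∑ b, p a * p a * (q b)⁻¹ * c a b ≤ w := by
    have h1 := trace_cfc_mul_cfc hA.isHermitian hB.isHermitian (fun x => x * x) (fun x => x⁻¹)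
    have h2 := trace_mul_mul_le hA.posSemidef (IsHermitian.cfc_isHermitian hB.isHermitian _)
      (PosDef.mul_cfc_inv hB) hw0 h
    rw [← IsHermitian.cfc_mul_cfc, IsHermitian.cfc_id_eq] at h1
    rw [h1, Complex.ofReal_re, hA1, Complex.one_re, mul_one] at h2
    exact h2
  rw [trace_mul_cfc_sub_sq, Complex.ofReal_re, ← hp, ← hq, ← hc]
  calc ∑ a, ∑ b, p a * (Real.log (p a) - Real.log (q b)) ^ 2 * c a b
      ≤ ∑ a, ∑ b, (2 * Real.log w ^ 2 * (p a * c a b)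
          + 6 / 5 / w * (p a * p a * (q b)⁻¹ * c a b) + 3 / 5 * (q b * c a b)) := by
        refine Finset.sum_le_sum fun a _ => Finset.sum_le_sum fun b _ => ?_
        have hpa : 0 < p a := hA.eigenvalues_pos a
        have hqb : 0 < q b := hB.eigenvalues_pos b
        have hcab : 0 ≤ c a b := eigenOverlap_nonneg _ _ a b
        rw [← Real.log_div hpa.ne' hqb.ne']
        refine (mul_le_mul_of_nonneg_right (mul_le_mul_of_nonneg_left
          (sq_log_le (w := w) (by linarith) (div_pos hpa hqb)) hpa.le) hcab).trans_eq ?_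
        field_simp
    _ = 2 * Real.log w ^ 2 * (∑ a, ∑ b, p a * c a b)
          + 6 / 5 / w * (∑ a, ∑ b, p a * p a * (q b)⁻¹ * c a b)
          + 3 / 5 * ∑ a, ∑ b, q b * c a b := by
        simp only [Finset.sum_add_distrib, Finset.mul_sum]
    _ ≤ 2 * Real.log w ^ 2 * 1 + 6 / 5 / w * w + 3 / 5 * 1 := by
        rw [hA', hB']
        gcongr
    _ ≤ 4 * Real.log w ^ 2 := by
        rw [div_mul_cancel₀ _ hw0.ne']
        nlinarith [one_le_log_of_three_le hw]

end PinchingBounds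

/-- **Lemma 5 (pinching log-variance bound).** If `M` refines the PVM `E`, the positive
definite density matrix `ρ` commutes with every element of `E`, and `w(E) ≥ 3`, then
`Tr(ρ (log ρ - log ℰ_M(ρ))²) ≤ 4 (log w(E))²`. -/
theorem stmt_11 (d : ℕ) (ι κ : Type) [Fintype ι] [Fintype κ]
    (E : ι → Matrix (Fin d) (Fin d) ℂ) (M : κ → Matrix (Fin d) (Fin d) ℂ)
    (hE : IsPVM E) (hM : IsPVM M) (hRef : Refines M E)
    (ρ : Matrix (Fin d) (Fin d) ℂ) (hρ : ρ.PosDef) (hρ1 : ρ.trace = 1)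
    (hcomm : ∀ i, ρ * E i = E i * ρ)
    (hw : 3 ≤ pvmWidth E) :
    (Matrix.trace (ρ * (matLog ρ - matLog (pinch M ρ)) ^ 2)).re
      ≤ 4 * Real.log (pvmWidth E) ^ 2 := by
  have hw' : (3 : ℝ) ≤ (pvmWidth E : ℝ) := by exact_mod_cast hw
  have hpsd := posSemidef_width_smul_pinch_sub hE hM hRef hρ.posSemidef hcomm
  have hσ : (pinch M ρ).PosDef := by
    have h1 : (((pvmWidth E : ℝ) : ℂ) • pinch M ρ).PosDef := by
      simpa using hρ.add_posSemidef hpsd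
    have hpos : (0 : ℝ) < (pvmWidth E : ℝ)⁻¹ := by positivity
    have h2 := h1.smul (show (0 : ℂ) < (((pvmWidth E : ℝ)⁻¹ : ℝ) : ℂ) by exact_mod_cast hpos)
    rwa [smul_smul, ← Complex.ofReal_mul, inv_mul_cancel₀ (by linarith), Complex.ofReal_one,
      one_smul] at h2
  rw [matLog, matLog, matFun, matFun, dif_pos hρ.isHermitian, dif_pos hσ.isHermitian]
  exact trace_mul_log_sub_log_sq_le hρ hσ hρ1 ((trace_pinch hM ρ).trans hρ1) hw' hpsd
end

section
/- Lemma 8: Let E and M be PVMs on ℂ^d with M refining E, and let ρ be a positive definite density matrix on ℂ^d commuting with every element of E. Then for every t with 0 < t ≤ 1, the operator inequality w(E)^t · ρ^{−t} ≥ (ℰ_M(ρ))^{−t} holds in the Loewner order, where matrix powers are taken by functional calculus. -/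
open scoped BigOperators Classical ComplexOrder
open Matrix Filter

open scoped MatrixOrder Matrix.Norms.L2Operator

section Auxiliary

variable {n κ : Type*} [Fintype n] [DecidableEq n]

theorem matFun_rpow_eq {A : Matrix n n ℂ} (hA : 0 ≤ A) (s : ℝ) :
    matFun (fun x : ℝ => Real.rpow x s) A = A ^ s := by
  have hH : A.IsHermitian := (Matrix.nonneg_iff_posSemidef.1 hA).isHermitian
  rw [matFun, dif_pos hH, ← hH.cfc_eq, CFC.rpow_eq_cfc_real hA]
  rfl

theorem rpow_neg_antitone {A B : Matrix n n ℂ} (hA : IsStrictlyPositive A) (hAB : A ≤ B)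
    {t : ℝ} (ht : t ∈ Set.Icc 0 1) : B ^ (-t) ≤ A ^ (-t) := by
  have hB : IsStrictlyPositive B := hA.of_le hAB
  have inv_rpow {C : Matrix n n ℂ} (hC : IsStrictlyPositive C) :
      C ^ (-t) = (C ^ t) ^ (-1 : ℝ) := by
    rcases eq_or_ne t 0 with rfl | h0
    · rw [neg_zero, CFC.rpow_zero C hC.nonneg, CFC.one_rpow]
    · rw [CFC.rpow_rpow C t (-1) h0 hC, mul_neg_one]
  rw [inv_rpow hA, inv_rpow hB]
  exact CStarAlgebra.rpow_neg_one_le_rpow_neg_one (CFC.rpow_le_rpow ht hAB)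
    (IsStrictlyPositive.rpow A t hA)

theorem smul_rpow {A : Matrix n n ℂ} (hA : IsStrictlyPositive A) {c : ℝ} (hc : 0 < c) (s : ℝ) :
    (c • A) ^ s = (c ^ s) • A ^ s := by
  have hpos : ∀ x ∈ spectrum ℝ A, 0 < x := fun x hx => hA.spectrum_pos hx
  rw [CFC.rpow_eq_cfc_real hA.nonneg, CFC.rpow_eq_cfc_real (smul_nonneg hc.le hA.nonneg),
    ← cfc_smul _ _ _ (fun x hx =>
      (Real.continuousAt_rpow_const x s (Or.inl (hpos x hx).ne')).continuousWithinAt),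
    ← cfc_comp_smul c (fun x : ℝ => x ^ s) A (by
      rintro _ ⟨x, hx, rfl⟩
      exact (Real.continuousAt_rpow_const _ s
        (Or.inl (mul_pos hc (hpos x hx)).ne')).continuousWithinAt) hA.isSelfAdjoint]
  exact cfc_congr fun x hx => Real.mul_rpow hc.le (hpos x hx).le

theorem trace_eq_rank_of_idempotent {A : Matrix n n ℂ} (hA : A * A = A) :
    A.trace = (A.rank : ℂ) := by
  have h : IsIdempotentElem (Matrix.toLin' A) := by
    rw [IsIdempotentElem, Module.End.mul_eq_comp, ← Matrix.toLin'_mul, hA]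
  rw [← Matrix.trace_toLin'_eq, LinearMap.IsProj.trace
    (LinearMap.IsIdempotentElem.isProj_range _ h)]
  rfl

theorem card_le_rank_of_eq_sum [Fintype κ] {E : Matrix n n ℂ} (hE : E * E = E) {M : κ → Matrix n n ℂ}
    (hM : IsPVM M) (s : Finset κ) (hs : E = ∑ j ∈ s, M j) : s.card ≤ E.rank := by
  have hrank : E.rank = ∑ j ∈ s, (M j).rank := by
    have h := congrArg Matrix.trace hs
    rw [Matrix.trace_sum, trace_eq_rank_of_idempotent hE,
      Finset.sum_congr rfl fun j _ => trace_eq_rank_of_idempotent (hM.idem j)] at h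
    exact_mod_cast h
  rw [hrank, Finset.card_eq_sum_ones]
  refine Finset.sum_le_sum fun j _ => Nat.one_le_iff_ne_zero.2 fun h => hM.ne_zero j ?_
  have hrange : LinearMap.range (M j).mulVecLin = ⊥ := Submodule.finrank_eq_zero.1 h
  exact Matrix.toLin'.map_eq_zero_iff.1 (LinearMap.range_eq_bot.1 hrange)

theorem sum_conj_le_card_smul {ρ : Matrix n n ℂ} (hρ : 0 ≤ ρ) {M : κ → Matrix n n ℂ}
    (hM : ∀ j, (M j).IsHermitian) (s : Finset κ) :
    (∑ j ∈ s, M j) * ρ * (∑ j ∈ s, M j) ≤ (s.card : ℝ) • ∑ j ∈ s, M j * ρ * M j := by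
  have hnonneg : 0 ≤ ∑ j ∈ s, ∑ k ∈ s, (M j - M k) * ρ * (M j - M k) :=
    Finset.sum_nonneg fun j _ => Finset.sum_nonneg fun k _ =>
      ((hM j).sub (hM k)).isSelfAdjoint.conjugate_nonneg hρ
  have hexpand : ∑ j ∈ s, ∑ k ∈ s, (M j - M k) * ρ * (M j - M k) =
      (2 : ℝ) • ((s.card : ℝ) • ∑ j ∈ s, M j * ρ * M j
        - (∑ j ∈ s, M j) * ρ * (∑ j ∈ s, M j)) := by
    have hcross : (∑ j ∈ s, M j) * ρ * (∑ j ∈ s, M j) = ∑ j ∈ s, ∑ k ∈ s, M j * ρ * M k := by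
      rw [Finset.sum_mul, Finset.sum_mul_sum]
    have hcross_comm : ∑ j ∈ s, ∑ k ∈ s, M k * ρ * M j = ∑ j ∈ s, ∑ k ∈ s, M j * ρ * M k :=
      Finset.sum_comm
    simp only [sub_mul, mul_sub, Finset.sum_sub_distrib, hcross, hcross_comm, Finset.sum_const,
      ← Finset.smul_sum, Nat.cast_smul_eq_nsmul, two_smul]
    abel
  rw [hexpand] at hnonneg
  have h := smul_nonneg (by norm_num : (0 : ℝ) ≤ 2⁻¹) hnonneg
  rw [inv_smul_smul₀ two_ne_zero] at h
  exact sub_nonneg.1 h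

/-- The pinching inequality for a refinement of a PVM commuting with `ρ`. -/
theorem le_pvmWidth_smul_pinch {ι : Type*} [Fintype ι] [Fintype κ]
    {E : ι → Matrix n n ℂ} {M : κ → Matrix n n ℂ}
    (hE : IsPVM E) (hM : IsPVM M) (hRef : Refines M E) {ρ : Matrix n n ℂ} (hρ : 0 ≤ ρ)
    (hcomm : ∀ i, ρ * E i = E i * ρ) : ρ ≤ (pvmWidth E : ℝ) • pinch M ρ := by
  obtain ⟨f, hf⟩ := hRef
  have hconj : ∀ j, 0 ≤ M j * ρ * M j := fun j =>
    (hM.herm j).isSelfAdjoint.conjugate_nonneg hρ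
  calc ρ = ∑ i, E i * ρ * E i := by
        simp_rw [← hcomm, mul_assoc, hE.idem, ← Finset.mul_sum, hE.sum_one, mul_one]
    _ ≤ ∑ i, (pvmWidth E : ℝ) • ∑ j with f j = i, M j * ρ * M j := by
        refine Finset.sum_le_sum fun i _ => ?_
        have hcard : (Finset.univ.filter fun j => f j = i).card ≤ pvmWidth E :=
          (card_le_rank_of_eq_sum (hE.idem i) hM _ (hf i)).trans
            (Finset.le_sup (f := fun i => (E i).rank) (Finset.mem_univ i))
        rw [hf i]
        exact (sum_conj_le_card_smul hρ hM.herm _).trans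
          (smul_le_smul_of_nonneg_right (by exact_mod_cast hcard)
            (Finset.sum_nonneg fun j _ => hconj j))
    _ = (pvmWidth E : ℝ) • pinch M ρ := by
        rw [← Finset.smul_sum, pinch]
        congr 1
        convert Finset.sum_fiberwise Finset.univ f fun j => M j * ρ * M j

end Auxiliary

/-- **Lemma 8.** If `M` refines the PVM `E` and the positive definite density matrix `ρ`
commutes with every element of `E`, then for `0 < t ≤ 1` the operator inequality
`w(E)^t • ρ^{-t} ≥ (ℰ_M(ρ))^{-t}` holds in the Loewner order. -/
theorem stmt_14 (d : ℕ) (ι κ : Type) [Fintype ι] [Fintype κ]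
    (E : ι → Matrix (Fin d) (Fin d) ℂ) (M : κ → Matrix (Fin d) (Fin d) ℂ)
    (hE : IsPVM E) (hM : IsPVM M) (hRef : Refines M E)
    (ρ : Matrix (Fin d) (Fin d) ℂ) (hρ : ρ.PosDef) (hρ1 : ρ.trace = 1)
    (hcomm : ∀ i, ρ * E i = E i * ρ)
    (t : ℝ) (ht0 : 0 < t) (ht1 : t ≤ 1) :
    ((((Real.rpow (pvmWidth E : ℝ) t : ℝ) : ℂ) •
        matFun (fun x : ℝ => Real.rpow x (-t)) ρ)
      - matFun (fun x : ℝ => Real.rpow x (-t)) (pinch M ρ)).PosSemidef := by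
  have hρpos : IsStrictlyPositive ρ := hρ.isStrictlyPositive
  have hle := le_pvmWidth_smul_pinch hE hM hRef hρpos.nonneg hcomm
  have hnt : Nontrivial (Matrix (Fin d) (Fin d) ℂ) := by
    refine ⟨ρ, 0, ?_⟩
    rintro rfl
    simp at hρ1
  have hstrict : IsStrictlyPositive ((pvmWidth E : ℝ) • pinch M ρ) :=
    hρpos.of_le hle
  have hw : (0 : ℝ) < pvmWidth E := by
    refine (Nat.cast_nonneg _).lt_of_ne fun h => ?_
    rw [← h, zero_smul] at hstrict
    exact not_isUnit_zero hstrict.isUnit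
  have hpinch : IsStrictlyPositive (pinch M ρ) := by
    have h := hstrict.smul (inv_pos.2 hw)
    rwa [inv_smul_smul₀ hw.ne'] at h
  have hanti := rpow_neg_antitone hρpos hle ⟨ht0.le, ht1⟩
  rw [smul_rpow hpinch hw] at hanti
  have h := smul_le_smul_of_nonneg_left hanti (Real.rpow_nonneg hw.le t)
  rw [smul_smul, ← Real.rpow_add hw, add_neg_cancel, Real.rpow_zero, one_smul] at h
  rw [matFun_rpow_eq hρpos.nonneg, matFun_rpow_eq hpinch.nonneg, ← Matrix.le_iff,
    Complex.coe_smul]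
  exact h
end
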